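/- Let d ≥ 1 and let G be a finite simple graph on n vertices. Let G' be obtained from G by successively adding k ≥ 0 new vertices, where each new vertex is joined by edges precisely to the d+1 vertices of some (d+1)-clique of the graph constructed so far (and to no other vertex). Then τ₀(G') = τ₀(G) + k/((d+2)(d+3)) − 1/(n+1) + 1/(n+k+1). (This is the i = 0 case of the formula for the change of the τ-vector under k bistellar (1,d+1)-moves, i.e. stacking operations, on a d-manifold.) -/

import Mathlib

open Finset

/-- `τ₀` of a finite simple graph. -/
noncomputable def tau0 {V : Type*} [Fintype V] (G : SimpleGraph V) : ℚ :=
  ((Fintype.card V : ℚ) + 1)⁻¹ *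
    ∑ W : Finset V,
      (if W.Nonempty then (Nat.card (G.induce (↑W : Set V)).ConnectedComponent : ℚ) - 1 else 0) /
        ((Fintype.card V).choose W.card : ℚ)

section Reachability

variable {V T : Type*}

theorem SimpleGraph.Reachable.map_eq {H : SimpleGraph V} {φ : V → T}
    (hφ : ∀ a b, H.Adj a b → φ a = φ b) {a b : V} (h : H.Reachable a b) : φ a = φ b := by
  obtain ⟨p⟩ := h
  induction p with
  | nil => rfl
  | cons hab _ ih => exact (hφ _ _ hab).trans ih

/-- A surjective labelling whose fibres are exactly the reachability classes counts the
connected components. -/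
theorem SimpleGraph.card_connectedComponent_eq {H : SimpleGraph V} {φ : V → T}
    (hsurj : Function.Surjective φ) (hφ : ∀ a b, H.Adj a b → φ a = φ b)
    (hreach : ∀ a b, φ a = φ b → H.Reachable a b) :
    Nat.card H.ConnectedComponent = Nat.card T := by
  refine Nat.card_eq_of_bijective
    (SimpleGraph.ConnectedComponent.lift φ fun _ _ p _ => Reachable.map_eq hφ ⟨p⟩) ⟨?_, ?_⟩
  · intro c c'
    induction c using SimpleGraph.ConnectedComponent.ind with | _ a
    induction c' using SimpleGraph.ConnectedComponent.ind with | _ b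
    intro h
    exact SimpleGraph.ConnectedComponent.sound (hreach a b h)
  · intro t
    obtain ⟨a, rfl⟩ := hsurj t
    exact ⟨H.connectedComponentMk a, rfl⟩

variable {G : SimpleGraph V} {v : V} {U : Set V}

theorem SimpleGraph.card_connectedComponent_induce_insert_of_isolated [Finite U] (hv : v ∉ U)
    (hiso : ∀ u ∈ U, ¬ G.Adj v u) :
    Nat.card (G.induce (insert v U)).ConnectedComponent
      = Nat.card (G.induce U).ConnectedComponent + 1 := by
  classical
  rw [← Finite.card_option]
  let φ : ↥(insert v U) → Option (G.induce U).ConnectedComponent := fun a =>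
    if h : a.1 ∈ U then some ((G.induce U).connectedComponentMk ⟨a.1, h⟩) else none
  refine SimpleGraph.card_connectedComponent_eq (φ := φ) ?_ ?_ ?_
  · rintro (_ | c)
    · exact ⟨⟨v, Set.mem_insert v U⟩, by simp [φ, hv]⟩
    · induction c using SimpleGraph.ConnectedComponent.ind with | _ a
      exact ⟨⟨a.1, Set.mem_insert_of_mem v a.2⟩, by simp [φ]⟩
  · rintro ⟨a, rfl | ha⟩ ⟨b, rfl | hb⟩ hab
    · rfl
    · exact absurd hab (hiso b hb)
    · exact absurd hab.symm (hiso a ha)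
    · simp only [φ, ha, hb, dite_true]
      exact congrArg some (SimpleGraph.ConnectedComponent.sound
        (SimpleGraph.Adj.reachable (show (G.induce U).Adj ⟨a, ha⟩ ⟨b, hb⟩ from hab)))
  · rintro ⟨a, rfl | ha⟩ ⟨b, rfl | hb⟩ hab
    · rfl
    · simp [φ, hv, hb] at hab
    · simp [φ, hv, ha] at hab
    · simp only [φ, ha, hb, dite_true, Option.some.injEq] at hab
      exact (SimpleGraph.ConnectedComponent.exact hab).map
        (G.induceHomOfLE (Set.subset_insert v U)).toHom

theorem SimpleGraph.card_connectedComponent_induce_insert_of_isClique {w : V} (hv : v ∉ U)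
    (hw : w ∈ U) (hvw : G.Adj v w) (hcl : ∀ u ∈ U, G.Adj v u → u ≠ w → G.Adj w u) :
    Nat.card (G.induce (insert v U)).ConnectedComponent
      = Nat.card (G.induce U).ConnectedComponent := by
  classical
  let r : ↥(insert v U) → U := fun a => if h : a.1 ∈ U then ⟨a.1, h⟩ else ⟨w, hw⟩
  have hrU : ∀ (a : V) (ha : a ∈ U), r ⟨a, Set.mem_insert_of_mem v ha⟩ = ⟨a, ha⟩ := fun a ha => by
    simp [r, ha]
  have hrv : r ⟨v, Set.mem_insert v U⟩ = ⟨w, hw⟩ := by simp [r, hv]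
  have hwr : ∀ (b : V) (hb : b ∈ U), G.Adj v b → (G.induce U).Reachable ⟨w, hw⟩ ⟨b, hb⟩ := by
    intro b hb hvb
    by_cases hbw : b = w
    · subst hbw; rfl
    · exact SimpleGraph.Adj.reachable
        (show (G.induce U).Adj ⟨w, hw⟩ ⟨b, hb⟩ from hcl b hb hvb hbw)
  let ι := (G.induceHomOfLE (Set.subset_insert v U)).toHom
  have hrr : ∀ a, (G.induce (insert v U)).Reachable a (ι (r a)) := by
    rintro ⟨a, rfl | ha⟩
    · rw [hrv]
      exact SimpleGraph.Adj.reachable (show G.Adj a w from hvw)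
    · rw [hrU a ha]; rfl
  refine SimpleGraph.card_connectedComponent_eq
    (φ := fun a => (G.induce U).connectedComponentMk (r a)) ?_ ?_ ?_
  · intro c
    induction c using SimpleGraph.ConnectedComponent.ind with | _ a
    exact ⟨⟨a.1, Set.mem_insert_of_mem v a.2⟩, congrArg _ (hrU a.1 a.2)⟩
  · rintro ⟨a, rfl | ha⟩ ⟨b, rfl | hb⟩ hab
    · rfl
    · refine SimpleGraph.ConnectedComponent.sound ?_
      rw [hrv, hrU b hb]
      exact hwr b hb hab
    · refine SimpleGraph.ConnectedComponent.sound ?_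
      rw [hrv, hrU a ha]
      exact (hwr a ha hab.symm).symm
    · refine SimpleGraph.ConnectedComponent.sound ?_
      rw [hrU a ha, hrU b hb]
      exact SimpleGraph.Adj.reachable (show G.Adj a b from hab)
  · intro a b hab
    exact (hrr a).trans (((SimpleGraph.ConnectedComponent.exact hab).map ι).trans (hrr b).symm)

end Reachability

section BetaWeight

/-- The value `1 / ((N + 1) * N.choose m)` of the Beta integral `∫ p ^ m * (1 - p) ^ (N - m)`
over `[0, 1]`. -/
noncomputable def betaWeight (N m : ℕ) : ℚ := (((N : ℚ) + 1) * (N.choose m : ℚ))⁻¹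

theorem betaWeight_eq_add {N m : ℕ} (h : m ≤ N) :
    betaWeight N m = betaWeight (N + 1) m + betaWeight (N + 1) (m + 1) := by
  obtain ⟨r, rfl⟩ := Nat.exists_eq_add_of_le h
  have h0 : ((m + r).choose m : ℚ) ≠ 0 := by
    exact_mod_cast (Nat.choose_pos (Nat.le_add_right m r)).ne'
  have h1 : ((m + r + 1).choose m : ℚ) = (m + r + 1) * (m + r).choose m / (r + 1) := by
    rw [eq_div_iff (by positivity)]
    have := Nat.choose_mul_succ_eq (m + r) m
    rw [show m + r + 1 - m = r + 1 by omega] at this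
    exact_mod_cast (this.symm.trans (mul_comm _ _))
  have h2 : ((m + r + 1).choose (m + 1) : ℚ) = (m + r + 1) * (m + r).choose m / (m + 1) := by
    rw [eq_div_iff (by positivity)]
    exact_mod_cast (Nat.add_one_mul_choose_eq (m + r) m).symm
  unfold betaWeight
  rw [h1, h2]
  push_cast
  have : (m + r + 1 : ℚ) ≠ 0 := by positivity
  have : (m + r + 1 + 1 : ℚ) ≠ 0 := by positivity
  field_simp
  ring

theorem sum_powerset_betaWeight {V : Type*} [DecidableEq V] {M j : ℕ} (hj : j ≤ M)
    (A : Finset V) :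
    ∑ W ∈ A.powerset, betaWeight (#A + M) (#W + j) = betaWeight M j := by
  induction A using Finset.induction_on with
  | empty => simp
  | insert x A hx ih =>
    rw [Finset.sum_powerset_insert hx, ← Finset.sum_add_distrib, ← ih]
    refine Finset.sum_congr rfl fun W hW => ?_
    have hWA := Finset.mem_powerset.1 hW
    have := Finset.card_le_card hWA
    rw [Finset.card_insert_of_notMem hx, Finset.card_insert_of_notMem fun h => hx (hWA h),
      betaWeight_eq_add (N := #A + M) (by omega)]
    congr 2 <;> ring

end BetaWeight

section ComponentSum

variable {V : Type*}

/-- The Beta-weighted sum of the numbers of connected components of the subgraphs induced on the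
subsets of `A`. -/
noncomputable def componentSum (G : SimpleGraph V) (A : Finset V) : ℚ :=
  ∑ W ∈ A.powerset,
    (Nat.card (G.induce (↑W : Set V)).ConnectedComponent : ℚ) * betaWeight #A #W

theorem componentSum_insert [DecidableEq V] {G : SimpleGraph V} {A S : Finset V} {v : V} {d : ℕ}
    (hv : v ∉ A) (hS : ∀ u, u ∈ S ↔ u ∈ A ∧ G.Adj u v) (hcard : #S = d + 1)
    (hcl : G.IsClique (↑S : Set V)) :
    componentSum G (insert v A)
      = componentSum G A + 1 / (((d : ℚ) + 2) * ((d : ℚ) + 3)) := by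
  have hSA : S ⊆ A := fun u hu => ((hS u).1 hu).1
  have hcount : ∀ W ∈ A.powerset,
      (Nat.card (G.induce (↑(insert v W) : Set V)).ConnectedComponent : ℚ)
        = Nat.card (G.induce (↑W : Set V)).ConnectedComponent
          + if W ⊆ A \ S then 1 else 0 := by
    intro W hW
    have hWA := Finset.mem_powerset.1 hW
    have hvW : v ∉ (↑W : Set V) := fun h => hv (hWA (Finset.mem_coe.1 h))
    rw [Finset.coe_insert]
    split_ifs with h
    · rw [SimpleGraph.card_connectedComponent_induce_insert_of_isolated hvW]
      · push_cast; rfl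
      · intro u hu hadj
        exact (Finset.mem_sdiff.1 (h hu)).2 ((hS u).2 ⟨hWA hu, hadj.symm⟩)
    · obtain ⟨w, hw, hw'⟩ := Finset.not_subset.1 h
      have hwS : w ∈ S := by
        by_contra hwS
        exact hw' (Finset.mem_sdiff.2 ⟨hWA hw, hwS⟩)
      rw [SimpleGraph.card_connectedComponent_induce_insert_of_isClique hvW
        (Finset.mem_coe.2 hw) ((hS w).1 hwS).2.symm, add_zero]
      intro u hu hvu huw
      exact hcl hwS ((hS u).2 ⟨hWA hu, hvu.symm⟩) huw.symm
  have hextra : ∑ W ∈ A.powerset,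
      (if W ⊆ A \ S then 1 else 0) * betaWeight (#A + 1) (#W + 1)
        = 1 / (((d : ℚ) + 2) * ((d : ℚ) + 3)) := by
    have hfilter : A.powerset.filter (· ⊆ A \ S) = (A \ S).powerset := by
      ext W
      simp only [Finset.mem_filter, Finset.mem_powerset]
      exact ⟨And.right, fun h => ⟨h.trans Finset.sdiff_subset, h⟩⟩
    simp only [ite_mul, one_mul, zero_mul]
    rw [← Finset.sum_filter, hfilter]
    have hA : #A + 1 = #(A \ S) + (d + 2) := by
      have := Finset.card_sdiff_add_card_eq_card hSA
      omega
    rw [hA, sum_powerset_betaWeight (by omega), betaWeight, Nat.choose_one_right]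
    push_cast
    rw [one_div]
    ring
  unfold componentSum
  rw [Finset.sum_powerset_insert hv, ← hextra, ← Finset.sum_add_distrib,
    ← Finset.sum_add_distrib]
  refine Finset.sum_congr rfl fun W hW => ?_
  have hWA := Finset.mem_powerset.1 hW
  rw [hcount W hW, Finset.card_insert_of_notMem hv,
    Finset.card_insert_of_notMem fun h => hv (hWA h),
    betaWeight_eq_add (Finset.card_le_card hWA)]
  ring

theorem tau0_eq_componentSum {X : Type*} [Fintype X] {H : SimpleGraph X} {G : SimpleGraph V}
    (f : H ↪g G) :
    tau0 H = componentSum G (Finset.univ.map f.toEmbedding) - 1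
      + 1 / ((Fintype.card X : ℚ) + 1) := by
  classical
  have hcount : ∀ W : Finset X,
      Nat.card (G.induce (↑(W.map f.toEmbedding) : Set V)).ConnectedComponent
        = Nat.card (H.induce (↑W : Set X)).ConnectedComponent := by
    intro W
    refine Nat.card_congr (SimpleGraph.Iso.connectedComponentEquiv ?_).symm
    rw [Finset.coe_map]
    exact ⟨Equiv.Set.image _ _ f.injective, f.map_adj_iff⟩
  have hsum : componentSum G (Finset.univ.map f.toEmbedding)
      = ∑ W : Finset X, (Nat.card (H.induce (↑W : Set X)).ConnectedComponent : ℚ)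
          * betaWeight (Fintype.card X) #W := by
    unfold componentSum
    symm
    refine Finset.sum_bij (fun W _ => W.map f.toEmbedding) ?_ ?_ ?_ ?_
    · intro W _
      exact Finset.mem_powerset.2 (Finset.map_subset_map.2 (Finset.subset_univ W))
    · intro W _ W' _ h
      exact Finset.map_injective _ h
    · intro W hW
      obtain ⟨W', _, rfl⟩ := Finset.subset_map_iff.1 (Finset.mem_powerset.1 hW)
      exact ⟨W', Finset.mem_univ _, rfl⟩
    · intro W _
      rw [hcount, Finset.card_map, Finset.card_map, Finset.card_univ]
  have hone : ∑ W : Finset X, betaWeight (Fintype.card X) #W = 1 := by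
    have := sum_powerset_betaWeight le_rfl (M := 0) (Finset.univ : Finset X)
    rw [Finset.powerset_univ] at this
    simpa [betaWeight] using this
  have hempty : ∑ W : Finset X, (if W = ∅ then betaWeight (Fintype.card X) #W else 0)
      = 1 / ((Fintype.card X : ℚ) + 1) := by
    simp [betaWeight]
  rw [hsum, ← hempty, ← hone, ← Finset.sum_sub_distrib, ← Finset.sum_add_distrib, tau0,
    Finset.mul_sum]
  refine Finset.sum_congr rfl fun W _ => ?_
  rcases W.eq_empty_or_nonempty with rfl | hW
  · simp
  · rw [if_pos hW, if_neg hW.ne_empty, betaWeight, mul_inv]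
    ring

end ComponentSum

theorem componentSum_stacking {d n k : ℕ} {G' : SimpleGraph (Fin (n + k))}
    (hstack : ∀ i : Fin (n + k), n ≤ (i : ℕ) →
      ({j : Fin (n + k) | j < i ∧ G'.Adj j i}).ncard = d + 1 ∧
        G'.IsClique {j : Fin (n + k) | j < i ∧ G'.Adj j i}) {t : ℕ} (ht : t ≤ k) :
    componentSum G' {j : Fin (n + k) | (j : ℕ) < n + t}
      = componentSum G' {j : Fin (n + k) | (j : ℕ) < n}
        + (t : ℚ) / (((d : ℚ) + 2) * ((d : ℚ) + 3)) := by
  classical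
  induction t with
  | zero => simp
  | succ t ih =>
    let v : Fin (n + k) := ⟨n + t, by omega⟩
    have hv : Finset.univ.filter (fun j : Fin (n + k) => (j : ℕ) < n + (t + 1))
        = insert v (Finset.univ.filter fun j : Fin (n + k) => (j : ℕ) < n + t) := by
      ext j
      simp only [Finset.mem_filter, Finset.mem_univ, true_and, Finset.mem_insert, v, Fin.ext_iff]
      omega
    obtain ⟨hcard, hcl⟩ := hstack v (Nat.le_add_right n t)
    have hS : (↑({j : Fin (n + k) | j < v ∧ G'.Adj j v} : Finset (Fin (n + k)))
        : Set (Fin (n + k))) = {j : Fin (n + k) | j < v ∧ G'.Adj j v} := by simp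
    rw [hv, componentSum_insert (S := {j : Fin (n + k) | j < v ∧ G'.Adj j v}) (d := d)
      (by simp [v]) (by simp [v, Fin.lt_def]) (by rw [← Set.ncard_coe_finset, hS, hcard])
      (by rwa [hS]), ih (by omega)]
    push_cast
    ring

/-- `i = 0` case of the stacking formula: let `G'` be a graph on `n + k`
vertices (vertices `Fin (n+k)`, the first `n` of which carry the original graph `G`, given as
the induced subgraph on them) such that each of the `k` new vertices is joined by edges
precisely to the `d+1` vertices of some `(d+1)`-clique of the graph constructed so far, i.e.
for every vertex `i ≥ n` its set of earlier neighbors has exactly `d+1` elements and is a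
clique.  Then `τ₀(G') = τ₀(G) + k/((d+2)(d+3)) − 1/(n+1) + 1/(n+k+1)`. -/
theorem tau0_stacking (d n k : ℕ) (hd : 1 ≤ d) (G' : SimpleGraph (Fin (n + k)))
    (hstack : ∀ i : Fin (n + k), n ≤ (i : ℕ) →
      ({j : Fin (n + k) | j < i ∧ G'.Adj j i}).ncard = d + 1 ∧
        G'.IsClique {j : Fin (n + k) | j < i ∧ G'.Adj j i}) :
    tau0 G'
      = tau0 (G'.induce {j : Fin (n + k) | (j : ℕ) < n})
        + (k : ℚ) / (((d : ℚ) + 2) * ((d : ℚ) + 3))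
        - 1 / ((n : ℚ) + 1) + 1 / ((n : ℚ) + (k : ℚ) + 1) := by
  have hG' := tau0_eq_componentSum (SimpleGraph.Embedding.refl (G := G'))
  have hG := tau0_eq_componentSum
    (SimpleGraph.Embedding.induce (G := G') {j : Fin (n + k) | (j : ℕ) < n})
  have huniv : Finset.univ.map (SimpleGraph.Embedding.refl (G := G')).toEmbedding
      = Finset.univ.filter fun j : Fin (n + k) => (j : ℕ) < n + k := by
    ext j
    simp
  have hsub : Finset.univ.map
      (SimpleGraph.Embedding.induce (G := G') {j : Fin (n + k) | (j : ℕ) < n}).toEmbedding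
      = Finset.univ.filter fun j : Fin (n + k) => (j : ℕ) < n := by
    ext j
    simp
  have hcard : Fintype.card {j : Fin (n + k) | (j : ℕ) < n} = n := by
    simp [Fintype.card_subtype, Fin.card_filter_val_lt]
  rw [huniv, Fintype.card_fin, componentSum_stacking hstack le_rfl] at hG'
  rw [hsub, hcard] at hG
  rw [hG', hG]
  push_cast
  ring
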